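/- Let p be an odd prime, m ∈ ℕ, and α, β ∈ ℤ. Set S = ∑_{a=0}^{p^m−1} e((2aα + a²β)/p^m). Then: (1) if β = 0 and p^m | α, then S = p^m; (2) if β = 0 and p^m ∤ α, then S = 0; (3) if β ≠ 0 and min(v_p(α), v_p(β)) ≥ m (with v_p(0) = ∞), then S = p^m; (4) if β ≠ 0, min(v_p(α), v_p(β)) < m, and v_p(β) > v_p(α), then S = 0; (5) if β ≠ 0, v := v_p(β) ≤ v_p(α), and v < m, then, writing δ = gcd(α,β), α₀ = α/δ, β₀ = β/δ (so p ∤ β₀), and choosing an integer q with β₀·q ≡ 1 (mod p^{m−v}), one has S = p^{(m+v)/2} · η(p^{m−v}) · ((β/p^v) | p^{m−v}) · e(−β·(α₀·q)²/p^m), and this value is independent of the choice of q. -/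

import Mathlib

/-- `e(t) = e^{2πit}`. -/
noncomputable def e2 (t : ℝ) : ℂ := Complex.exp (2 * Real.pi * Complex.I * t)

/-- `η(n)` is the complex conjugate of `(1 + i^n)/(1 + i)`. -/
noncomputable def eta (n : ℕ) : ℂ :=
  starRingEnd ℂ ((1 + Complex.I ^ n) / (1 + Complex.I))


noncomputable def EE (N : ℕ) (j : ℤ) : ℂ := e2 ((j : ℝ) / (N : ℝ))

lemma EE_add (N : ℕ) (i j : ℤ) : EE N (i + j) = EE N i * EE N j := by
  unfold EE e2
  rw [← Complex.exp_add]
  congr 1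
  push_cast
  ring

lemma EE_zero (N : ℕ) : EE N 0 = 1 := by
  simp [EE, e2]

lemma EE_eq_one_iff (N : ℕ) (hN : 0 < N) (j : ℤ) : EE N j = 1 ↔ (N : ℤ) ∣ j := by
  unfold EE e2
  have hN' : (N : ℂ) ≠ 0 := by exact_mod_cast hN.ne'
  have hpi := Complex.two_pi_I_ne_zero
  rw [Complex.exp_eq_one_iff]
  constructor
  · rintro ⟨n, hn⟩
    refine ⟨n, ?_⟩
    have h1 : (2 * Real.pi * Complex.I) * ((j : ℂ) / N) = (2 * Real.pi * Complex.I) * n := by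
      rw [mul_comm _ (n : ℂ), ← hn]; push_cast; ring
    have h2 := mul_left_cancel₀ hpi h1
    rw [div_eq_iff hN'] at h2
    have : (j : ℂ) = ((N * n : ℤ) : ℂ) := by rw [h2]; push_cast; ring
    exact_mod_cast this
  · rintro ⟨n, rfl⟩
    refine ⟨n, ?_⟩
    push_cast
    field_simp

lemma EE_congr (N : ℕ) (hN : 0 < N) {i j : ℤ} (h : i ≡ j [ZMOD N]) : EE N i = EE N j := by
  have h1 : j = i + (j - i) := by ring
  rw [h1, EE_add, (EE_eq_one_iff N hN _).2 h.dvd, mul_one]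

lemma EE_mul (N M : ℕ) (hM : 0 < M) (j : ℤ) : EE (N * M) (M * j) = EE N j := by
  unfold EE
  congr 1
  have hM' : (M : ℝ) ≠ 0 := by exact_mod_cast hM.ne'
  push_cast
  rw [mul_comm (N : ℝ), mul_div_mul_left _ _ hM']

lemma EE_nat_mul (N : ℕ) (k : ℕ) (j : ℤ) : EE N (k * j) = EE N j ^ k := by
  induction k with
  | zero => simp [EE_zero]
  | succ k ih =>
    rw [pow_succ, ← ih, ← EE_add]; congr 1; push_cast; ring

lemma EE_neg (N : ℕ) (j : ℤ) : EE N (-j) = (EE N j)⁻¹ := by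
  refine eq_inv_of_mul_eq_one_left ?_
  rw [← EE_add, neg_add_cancel, EE_zero]

lemma EE_ne_zero (N : ℕ) (j : ℤ) : EE N j ≠ 0 := Complex.exp_ne_zero _

lemma EE_conj (N : ℕ) (j : ℤ) : starRingEnd ℂ (EE N j) = EE N (-j) := by
  unfold EE e2
  rw [← Complex.exp_conj]
  congr 1
  simp only [map_mul, map_ofNat, Complex.conj_ofReal, Complex.conj_I]
  push_cast
  ring

lemma EE_sum (N : ℕ) (hN : 0 < N) (j : ℤ) :
    ∑ a ∈ Finset.range N, EE N (a * j) = if (N : ℤ) ∣ j then (N : ℂ) else 0 := by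
  simp_rw [EE_nat_mul]
  split_ifs with h
  · rw [(EE_eq_one_iff N hN j).2 h]; simp
  · have h1 : EE N j ≠ 1 := fun h' => h ((EE_eq_one_iff N hN j).1 h')
    rw [geom_sum_eq h1, ← EE_nat_mul, (EE_eq_one_iff N hN _).2 (Dvd.intro _ rfl)]
    simp

lemma sum_range_zmod (N : ℕ) [NeZero N] (f : ℕ → ℂ) :
    ∑ a ∈ Finset.range N, f a = ∑ x : ZMod N, f x.val := by
  obtain ⟨n, rfl⟩ := Nat.exists_eq_succ_of_ne_zero (NeZero.ne N)
  rw [Finset.sum_range]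
  rfl

lemma per_congr (N : ℕ) (f : ℤ → ℂ) (hf : ∀ a, f (a + N) = f a) (i j : ℤ)
    (h : (i : ZMod N) = j) : f i = f j := by
  rw [ZMod.intCast_eq_intCast_iff] at h
  obtain ⟨k, hk⟩ := h.dvd
  have h2 : j = i + k * (N : ℤ) := by linarith
  have h3 : Function.Periodic f (N : ℤ) := hf
  rw [h2]
  exact (h3.int_mul k i).symm

lemma sum_shift (N : ℕ) (hN : 0 < N) (f : ℤ → ℂ) (hf : ∀ a, f (a + N) = f a) (c : ℤ) :
    ∑ a ∈ Finset.range N, f (a + c) = ∑ a ∈ Finset.range N, f a := by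
  have : NeZero N := ⟨hN.ne'⟩
  rw [sum_range_zmod N (fun a => f (a + c)), sum_range_zmod N (fun a => f a)]
  refine Fintype.sum_equiv (Equiv.addRight (c : ZMod N)) _ _ ?_
  intro x
  apply per_congr N f hf
  simp

lemma sum_range_mul' (A B : ℕ) (f : ℕ → ℂ) :
    ∑ a ∈ Finset.range (A * B), f a =
      ∑ y ∈ Finset.range B, ∑ x ∈ Finset.range A, f (x + A * y) := by
  induction B with
  | zero => simp
  | succ B ih =>
    rw [Nat.mul_succ, Finset.sum_range_add, ih, Finset.sum_range_succ]
    congr 1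
    exact Finset.sum_congr rfl fun x _ => by rw [add_comm]

lemma sum_per_mul (N M : ℕ) (f : ℤ → ℂ) (hf : ∀ a, f (a + N) = f a) :
    ∑ a ∈ Finset.range (N * M), f a = M * ∑ a ∈ Finset.range N, f a := by
  rw [sum_range_mul' N M (fun a => f a)]
  have : ∀ y ∈ Finset.range M, ∑ x ∈ Finset.range N, f ((x + N * y : ℕ) : ℤ)
      = ∑ a ∈ Finset.range N, f a := by
    intro y _
    refine Finset.sum_congr rfl fun x _ => ?_
    apply per_congr N f hf
    simp
  rw [Finset.sum_congr rfl this]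
  simp

noncomputable def qb (q : ℂ) : ℕ → ℕ → ℂ
  | _, 0 => 1
  | 0, _ + 1 => 0
  | n + 1, k + 1 => qb q n k + q ^ (k + 1) * qb q n (k + 1)

lemma qb_zero (q : ℂ) (n : ℕ) : qb q n 0 = 1 := by cases n <;> rfl
lemma qb_zero_succ (q : ℂ) (k : ℕ) : qb q 0 (k + 1) = 0 := rfl
lemma qb_succ (q : ℂ) (n k : ℕ) :
    qb q (n + 1) (k + 1) = qb q n k + q ^ (k + 1) * qb q n (k + 1) := rfl

lemma qb_big (q : ℂ) (n : ℕ) : ∀ k, n < k → qb q n k = 0 := by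
  induction n with
  | zero =>
    intro k hk
    obtain ⟨k, rfl⟩ := Nat.exists_eq_succ_of_ne_zero hk.ne'
    rfl
  | succ n ih =>
    intro k hk
    obtain ⟨k, rfl⟩ := Nat.exists_eq_succ_of_ne_zero (by omega : k ≠ 0)
    rw [Nat.succ_eq_add_one, qb_succ, ih k (by omega), ih (k + 1) (by omega)]; simp

lemma qb_absorb (q : ℂ) (n : ℕ) : ∀ k,
    (1 - q ^ (k + 1)) * qb q (n + 1) (k + 1) = (1 - q ^ (n + 1)) * qb q n k := by
  induction n with
  | zero =>
    intro k
    rw [qb_succ, qb_zero_succ]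
    cases k with
    | zero => simp
    | succ k => simp [qb_zero_succ]
  | succ n ih =>
    have hQ : ∀ k, q ^ k * (1 - q ^ (n + 1)) * qb q n k = (q ^ k - q ^ (n + 1)) * qb q (n + 1) k := by
      intro k
      cases k with
      | zero => simp [qb_zero]
      | succ j =>
        have h1 := ih j
        have h2 := qb_succ q n j
        linear_combination (-(1 - q ^ (n + 1))) * h2 + h1
    intro k
    have h1 := ih k
    have h2 := qb_succ q (n + 1) k
    have h3 := hQ k
    linear_combination (1 - q ^ (k + 1)) * h2 + q ^ (k + 1) * h1 + q * h3

noncomputable def qA (q : ℂ) (n : ℕ) : ℂ := ∑ k ∈ Finset.range (n + 1), (-1) ^ k * qb q n k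
noncomputable def qB (q : ℂ) (n : ℕ) : ℂ := ∑ k ∈ Finset.range (n + 1), (-1) ^ k * (q ^ k * qb q n k)

lemma qA_succ (q : ℂ) (n : ℕ) : qA q (n + 1) = - qA q n + qB q n := by
  have hB : qB q n = ∑ k ∈ Finset.range (n + 1), (-1) ^ (k + 1) * (q ^ (k + 1) * qb q n (k + 1)) + 1 := by
    have := Finset.sum_range_succ' (fun k => (-1) ^ k * (q ^ k * qb q n k)) (n + 1)
    rw [Finset.sum_range_succ, qb_big q n (n + 1) (by omega)] at this
    simpa [qb_zero, qB] using this
  unfold qA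
  rw [Finset.sum_range_succ', hB]
  simp only [qb_succ, qb_zero, mul_add, Finset.sum_add_distrib]
  rw [← Finset.sum_neg_distrib]
  have : ∀ k ∈ Finset.range (n + 1), (-1 : ℂ) ^ (k + 1) * qb q n k = -((-1) ^ k * qb q n k) := by
    intro k _; ring
  rw [Finset.sum_congr rfl this]
  ring

lemma qAB (q : ℂ) (n : ℕ) : qA q (n + 1) - qB q (n + 1) = -(1 - q ^ (n + 1)) * qA q n := by
  unfold qA qB
  rw [← Finset.sum_sub_distrib, Finset.sum_range_succ', Finset.mul_sum]
  have : ∀ k ∈ Finset.range (n + 1), (-1 : ℂ) ^ (k + 1) * qb q (n + 1) (k + 1) -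
      (-1) ^ (k + 1) * (q ^ (k + 1) * qb q (n + 1) (k + 1))
      = -(1 - q ^ (n + 1)) * ((-1) ^ k * qb q n k) := by
    intro k _
    have := qb_absorb q n k
    linear_combination (-1) ^ (k + 1) * this
  rw [Finset.sum_congr rfl this]
  simp

lemma qA_two (q : ℂ) (n : ℕ) : qA q (n + 2) = (1 - q ^ (n + 1)) * qA q n := by
  have h1 := qA_succ q (n + 1)
  have h2 := qAB q n
  linear_combination h1 - h2

lemma qA_even (q : ℂ) (m : ℕ) : qA q (2 * m) = ∏ j ∈ Finset.range m, (1 - q ^ (2 * j + 1)) := by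
  induction m with
  | zero => simp [qA, qb_zero]
  | succ m ih => rw [Finset.prod_range_succ, ← ih, Nat.mul_succ, qA_two, mul_comm]

lemma qb_root (q r : ℂ) (n : ℕ) (hr : r * q = 1) (hq : q ^ (n + 1) = 1)
    (hq' : ∀ k, 0 < k → k < n + 1 → q ^ k ≠ 1) (k : ℕ) (hk : k < n) :
    (-1) ^ (k + 1) * qb q n (k + 1) = r ^ (k + 1) * ((-1) ^ k * qb q n k) := by
  have h0 : qb q (n + 1) (k + 1) = 0 := by
    have := qb_absorb q n k
    rw [hq, sub_self, zero_mul, mul_eq_zero] at this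
    rcases this with h | h
    · exact absurd (sub_eq_zero.1 h).symm (hq' _ (by omega) (by omega))
    · exact h
  rw [qb_succ] at h0
  have h1 : r ^ (k + 1) * q ^ (k + 1) = 1 := by rw [← mul_pow, hr, one_pow]
  linear_combination (-1) ^ (k + 1) * r ^ (k + 1) * h0 - (-1) ^ (k + 1) * qb q n (k + 1) * h1


noncomputable def GG (N : ℕ) (b : ℤ) : ℂ := ∑ a ∈ Finset.range N, EE N (b * (a : ℤ) ^ 2)

lemma EE_sq_per (N : ℕ) (hN : 0 < N) (b c : ℤ) (a : ℤ) :
    EE N (b * (a + N) ^ 2 + c * (a + N)) = EE N (b * a ^ 2 + c * a) := by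
  apply EE_congr N hN
  apply Int.ModEq.symm
  rw [Int.modEq_iff_dvd]
  exact ⟨b * (2 * a + N) + c, by ring⟩

lemma GG_shift (N : ℕ) (hN : 0 < N) (b c : ℤ) :
    ∑ a ∈ Finset.range N, EE N (b * ((a : ℤ) + c) ^ 2) = GG N b := by
  refine sum_shift N hN (fun a => EE N (b * a ^ 2)) (fun a => ?_) c
  simpa using EE_sq_per N hN b 0 a

lemma GG_prod (m : ℕ) : GG (2 * m + 1) 1 =
    ∏ j ∈ Finset.range m, (2 * Complex.I * (Real.sin (2 * Real.pi * (2 * j + 1) / (2 * m + 1)) : ℝ)) := by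
  set n := 2 * m + 1 with hn
  have hn0 : 0 < n := by omega
  set q := EE n (-2) with hq
  set r := EE n 2 with hr
  have hrq : r * q = 1 := by rw [hr, hq, ← EE_add]; simp [EE_zero]
  have hc : ∀ k, k ≤ 2 * m → (-1) ^ k * qb q (2 * m) k = EE n (k * (k + 1)) := by
    intro k
    induction k with
    | zero => intro _; simp [qb_zero, EE_zero]
    | succ k ih =>
      intro hk
      rw [qb_root q r (2 * m) hrq ?_ ?_ k (by omega), ih (by omega), hr, ← EE_nat_mul, ← EE_add]
      · congr 1; push_cast; ring
      · rw [hq, ← EE_nat_mul, EE_eq_one_iff n hn0]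
        exact ⟨-2, by push_cast [hn]; ring⟩
      · intro k hk0 hk1
        rw [hq, ← EE_nat_mul, Ne, EE_eq_one_iff n hn0]
        intro h
        have h2 : IsCoprime (n : ℤ) (-2) := ⟨1, m, by push_cast [hn]; ring⟩
        have h3 := h2.dvd_of_dvd_mul_right h
        have := Int.le_of_dvd (by omega) h3
        omega
  have h1 : qA q (2 * m) = EE n (-(m : ℤ) ^ 2) * GG n 1 := by
    rw [← GG_shift n hn0 1 (m + 1), Finset.mul_sum]
    unfold qA
    refine Finset.sum_congr rfl fun k hk => ?_
    rw [hc k (by simp at hk; omega), ← EE_add]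
    apply EE_congr n hn0
    rw [Int.modEq_iff_dvd]
    exact ⟨k + 1, by push_cast [hn]; ring⟩
  have h2 : ∀ j : ℕ, 1 - q ^ (2 * j + 1) = EE n (-(2 * j + 1)) *
      (2 * Complex.I * (Real.sin (2 * Real.pi * (2 * j + 1) / (2 * m + 1)) : ℝ)) := by
    intro j
    have e1 : q ^ (2 * j + 1) = EE n (-(2 * j + 1)) * EE n (-(2 * j + 1)) := by
      rw [hq, ← EE_nat_mul, ← EE_add]; congr 1; push_cast; ring
    have e2' : EE n (-(2 * j + 1)) * EE n (2 * j + 1) = 1 := by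
      rw [← EE_add, neg_add_cancel, EE_zero]
    have e3 : (2 * Complex.I * (Real.sin (2 * Real.pi * (2 * j + 1) / (2 * m + 1)) : ℝ))
        = EE n (2 * j + 1) - EE n (-(2 * j + 1)) := by
      rw [Complex.ofReal_sin, Complex.sin]
      unfold EE e2
      have x1 : (2 * Real.pi * Complex.I * (((((2 * j + 1 : ℤ) : ℝ) / (n : ℝ)) : ℝ) : ℂ)) =
        ((2 * Real.pi * (2 * j + 1) / (2 * m + 1) : ℝ) : ℂ) * Complex.I := by
        push_cast [hn]; ring
      have x2 : (2 * Real.pi * Complex.I * (((((-(2 * j + 1) : ℤ) : ℝ) / (n : ℝ)) : ℝ) : ℂ)) =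
        -((2 * Real.pi * (2 * j + 1) / (2 * m + 1) : ℝ) : ℂ) * Complex.I := by
        push_cast [hn]; ring
      rw [x1, x2]
      linear_combination (Complex.exp (-((2 * Real.pi * (2 * j + 1) / (2 * m + 1) : ℝ) : ℂ) * Complex.I) -
        Complex.exp (((2 * Real.pi * (2 * j + 1) / (2 * m + 1) : ℝ) : ℂ) * Complex.I)) * Complex.I_sq
    rw [e3, e1]
    linear_combination - e2'
  have h3 : ∀ M : ℕ, ∏ j ∈ Finset.range M, EE n (-(2 * (j : ℤ) + 1)) = EE n (-(M : ℤ) ^ 2) := by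
    intro M
    induction M with
    | zero => simp [EE_zero]
    | succ M ih =>
      rw [Finset.prod_range_succ, ih, ← EE_add]; congr 1; push_cast; ring
  rw [qA_even, Finset.prod_congr rfl (fun j _ => h2 j), Finset.prod_mul_distrib, h3] at h1
  exact (mul_left_cancel₀ (EE_ne_zero _ _) h1).symm

lemma GG_norm (n : ℕ) (hodd : Odd n) : GG n 1 * starRingEnd ℂ (GG n 1) = n := by
  have hn0 : 0 < n := hodd.pos
  conv_lhs => rw [GG, mul_comm]
  rw [map_sum, Finset.sum_mul_sum]
  have h1 : ∀ b ∈ Finset.range n, ∑ a ∈ Finset.range n,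
      starRingEnd ℂ (EE n (1 * (b : ℤ) ^ 2)) * EE n (1 * (a : ℤ) ^ 2)
      = ∑ d ∈ Finset.range n, EE n ((d : ℤ) ^ 2) * EE n (b * (2 * d)) := by
    intro b _
    rw [← sum_shift n hn0 (fun a => starRingEnd ℂ (EE n (1 * (b : ℤ) ^ 2)) * EE n (1 * a ^ 2)) ?_ b]
    · refine Finset.sum_congr rfl fun d _ => ?_
      rw [EE_conj, ← EE_add, ← EE_add]; congr 1; ring
    · intro a
      congr 1
      simpa using EE_sq_per n hn0 1 0 a
  rw [Finset.sum_congr rfl h1, Finset.sum_comm]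
  simp_rw [← Finset.mul_sum, EE_sum n hn0]
  rw [Finset.sum_eq_single 0]
  · simp [EE_zero]
  · intro d hd hd0
    rw [if_neg, mul_zero]
    intro h
    have h2 : IsCoprime (n : ℤ) 2 := by
      obtain ⟨k, hk⟩ := hodd
      exact ⟨1, -k, by push_cast [hk]; ring⟩
    have h3 := h2.dvd_of_dvd_mul_left h
    have := Int.le_of_dvd (by omega) h3
    simp at hd
    omega
  · simp; omega

lemma sin_prod_sign (m : ℕ) : ∃ R : ℝ, 0 < R ∧
    ∏ j ∈ Finset.range m, (2 * Real.sin (2 * Real.pi * (2 * j + 1) / (2 * m + 1))) = (-1) ^ (m / 2) * R := by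
  have hpi := Real.pi_pos
  have h1 : 0 < ∏ j ∈ Finset.range ((m + 1) / 2), (2 * Real.sin (2 * Real.pi * (2 * j + 1) / (2 * m + 1))) := by
    apply Finset.prod_pos
    intro j hj
    have hj : 2 * (2 * j + 1) < 2 * m + 1 := by simp at hj; omega
    have hj' : (2 * (2 * j + 1) : ℝ) < 2 * m + 1 := by exact_mod_cast hj
    have := Real.sin_pos_of_pos_of_lt_pi (x := 2 * Real.pi * (2 * j + 1) / (2 * m + 1)) (by positivity)
      (by rw [div_lt_iff₀ (by positivity)]; nlinarith)
    linarith
  have h2 : 0 < ∏ j ∈ Finset.range (m / 2), -(2 * Real.sin (2 * Real.pi * (2 * (((m + 1) / 2 + j : ℕ) : ℝ) + 1) / (2 * m + 1))) := by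
    apply Finset.prod_pos
    intro j hj
    generalize hi : (m + 1) / 2 + j = i
    have hj1 : 2 * m + 1 < 2 * (2 * i + 1) := by simp at hj; omega
    have hj2 : (2 * i + 1) < 2 * m + 1 := by simp at hj; omega
    have hj1' : (2 * m + 1 : ℝ) < 2 * (2 * i + 1) := by exact_mod_cast hj1
    have hj2' : (2 * i + 1 : ℝ) < 2 * m + 1 := by exact_mod_cast hj2
    have := Real.sin_pos_of_pos_of_lt_pi (x := 2 * Real.pi * (2 * i + 1) / (2 * m + 1) - Real.pi)
      (by rw [sub_pos, lt_div_iff₀ (by positivity)]; nlinarith)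
      (by rw [sub_lt_iff_lt_add, div_lt_iff₀ (by positivity)]; nlinarith)
    rw [Real.sin_sub_pi] at this
    linarith
  refine ⟨_, mul_pos h1 h2, ?_⟩
  rw [Finset.prod_neg, Finset.card_range]
  conv_lhs => rw [show Finset.range m = Finset.range ((m + 1) / 2 + m / 2) by congr 1; omega]
  rw [Finset.prod_range_add]
  have : ((-1 : ℝ) ^ (m / 2)) * (-1) ^ (m / 2) = 1 := by rw [← mul_pow]; simp
  linear_combination (-(∏ j ∈ Finset.range ((m + 1) / 2), (2 * Real.sin (2 * Real.pi * (2 * j + 1) / (2 * m + 1)))) * ∏ j ∈ Finset.range (m / 2), (2 * Real.sin (2 * Real.pi * (2 * (((m + 1) / 2 + j : ℕ) : ℝ) + 1) / (2 * m + 1)))) * this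

lemma eta_odd (m : ℕ) : eta (2 * m + 1) = Complex.I ^ m * (-1) ^ (m / 2) := by
  unfold eta
  have hne : (1 + Complex.I) ≠ 0 := by
    intro h; have := congrArg Complex.re h; simp at this
  obtain ⟨k, hk | hk⟩ := Nat.even_or_odd' m
  · have : m / 2 = k := by omega
    have h1 : Complex.I ^ (2 * (2 * k) + 1) = Complex.I := by
      rw [show 2 * (2 * k) + 1 = 4 * k + 1 by ring, pow_add, pow_mul, Complex.I_pow_four]; simp
    rw [this, hk, h1, pow_mul, Complex.I_sq, ← mul_pow]
    simp [div_self hne]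
  · have : m / 2 = k := by omega
    have h1 : Complex.I ^ (2 * (2 * k + 1) + 1) = Complex.I ^ 3 := by
      rw [show 2 * (2 * k + 1) + 1 = 4 * k + 3 by ring, pow_add, pow_mul, Complex.I_pow_four]; simp
    have h4 : Complex.I ^ (2 * k + 1) = (-1) ^ k * Complex.I := by
      rw [pow_succ, pow_mul, Complex.I_sq]
    have h2 : ((-1 : ℂ) ^ k) * (-1) ^ k = 1 := by rw [← mul_pow]; simp
    have h3 : (1 + Complex.I ^ 3) / (1 + Complex.I) = - Complex.I := by
      rw [div_eq_iff hne]
      linear_combination (Complex.I + 1) * Complex.I_sq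
    rw [this, hk, h1, h4, h3, map_neg, Complex.conj_I]
    linear_combination (-Complex.I) * h2

lemma GG_one (n : ℕ) (hodd : Odd n) : GG n 1 = (Real.sqrt n : ℝ) * eta n := by
  have hnorm := GG_norm n hodd
  obtain ⟨m, rfl⟩ := hodd
  obtain ⟨R, hR, hprod⟩ := sin_prod_sign m
  have h1 : GG (2 * m + 1) 1 = R * eta (2 * m + 1) := by
    rw [GG_prod, eta_odd]
    have : ∀ j ∈ Finset.range m, (2 * Complex.I * (Real.sin (2 * Real.pi * (2 * j + 1) / (2 * m + 1)) : ℝ))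
      = Complex.I * ((2 * Real.sin (2 * Real.pi * (2 * j + 1) / (2 * m + 1)) : ℝ) : ℂ) := by
      intro j _; push_cast; ring
    rw [Finset.prod_congr rfl this, Finset.prod_mul_distrib, ← Complex.ofReal_prod, hprod]
    simp
    ring
  have h2 : eta (2 * m + 1) * starRingEnd ℂ (eta (2 * m + 1)) = 1 := by
    rw [eta_odd]
    simp only [map_mul, map_pow, Complex.conj_I, map_neg, map_one]
    rw [mul_mul_mul_comm, ← mul_pow, ← mul_pow]
    simp
  rw [h1] at hnorm ⊢
  rw [map_mul, mul_mul_mul_comm, h2, mul_one, Complex.conj_ofReal] at hnorm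
  have h3 : R * R = ((2 * m + 1 : ℕ) : ℝ) := by exact_mod_cast hnorm
  rw [← h3, Real.sqrt_mul_self hR.le]

lemma GG_rec (p : ℕ) (hp : p.Prime) (hodd : Odd p) (b : ℤ) (hb : ¬ (p : ℤ) ∣ b) (k : ℕ) :
    GG (p ^ (k + 2)) b = p * GG (p ^ k) b := by
  have hp0 := hp.pos
  have hN : 0 < p ^ (k + 2) := by positivity
  have hpZ : Prime (p : ℤ) := Nat.prime_iff_prime_int.1 hp
  have hp2 : ¬ (p : ℤ) ∣ 2 := by
    intro h
    have := Int.le_of_dvd (by norm_num) h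
    have h2 := hp.two_le
    have : p = 2 := by omega
    subst this
    exact absurd hodd (by decide)
  unfold GG
  conv_lhs => rw [show Finset.range (p ^ (k + 2)) = Finset.range (p ^ (k + 1) * p) by rw [← pow_succ]]
  rw [sum_range_mul' (p ^ (k + 1)) p (fun a => EE (p ^ (k + 2)) (b * (a : ℤ) ^ 2)), Finset.sum_comm]
  have h1 : ∀ x : ℕ, ∑ y ∈ Finset.range p, EE (p ^ (k + 2)) (b * ((x + p ^ (k + 1) * y : ℕ) : ℤ) ^ 2)
      = EE (p ^ (k + 2)) (b * (x : ℤ) ^ 2) * if (p : ℤ) ∣ x then (p : ℂ) else 0 := by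
    intro x
    have e1 : ∀ y : ℕ, EE (p ^ (k + 2)) (b * ((x + p ^ (k + 1) * y : ℕ) : ℤ) ^ 2)
        = EE (p ^ (k + 2)) (b * (x : ℤ) ^ 2) * EE p (y * (2 * b * x)) := by
      intro y
      rw [← EE_mul p (p ^ (k + 1)) (by positivity) (y * (2 * b * x)), ← pow_succ', ← EE_add]
      apply EE_congr _ hN
      apply Int.ModEq.symm
      rw [Int.modEq_iff_dvd]
      exact ⟨b * p ^ k * y ^ 2, by push_cast; ring⟩
    simp_rw [e1]
    rw [← Finset.mul_sum, EE_sum p hp0]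
    congr 1
    apply if_congr _ rfl rfl
    constructor
    · intro h
      rcases hpZ.dvd_or_dvd h with h | h
      · rcases hpZ.dvd_or_dvd h with h | h
        · exact absurd h hp2
        · exact absurd h hb
      · exact h
    · intro h; exact Dvd.dvd.mul_left h _
  simp_rw [h1]
  rw [pow_succ' p k, sum_range_mul' p (p ^ k) (fun x => EE (p ^ (k + 2)) (b * (x : ℤ) ^ 2) * if (p : ℤ) ∣ x then (p : ℂ) else 0),
    Finset.mul_sum]
  refine Finset.sum_congr rfl fun z _ => ?_
  rw [Finset.sum_eq_single 0]
  · rw [if_pos ⟨z, by push_cast; ring⟩, mul_comm, ← EE_mul (p ^ k) (p ^ 2) (by positivity), ← pow_add]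
    congr 2
    push_cast; ring
  · intro r hr hr0
    rw [if_neg, mul_zero]
    intro h
    have h2 : (p : ℤ) ∣ r := by
      have : (r : ℤ) = ((r + p * z : ℕ) : ℤ) - p * z := by push_cast; ring
      rw [this]
      exact dvd_sub h (Dvd.intro _ rfl)
    have := Int.le_of_dvd (by omega) h2
    simp at hr
    omega
  · simp; omega

lemma GG_prime (p : ℕ) (hp : p.Prime) (hodd : Odd p) (b : ℤ) (hb : ¬ (p : ℤ) ∣ b) :
    GG p b = (jacobiSym b p : ℂ) * GG p 1 := by
  have : Fact p.Prime := ⟨hp⟩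
  have hp2 : p ≠ 2 := by rintro rfl; exact absurd hodd (by decide)
  set χ : MulChar (ZMod p) ℂ := (quadraticChar (ZMod p)).ringHomComp (Int.castRingHom ℂ) with hχ
  have key : ∀ c : ℤ, ¬ (p : ℤ) ∣ c →
      GG p c = gaussSum χ ((ZMod.stdAddChar (N := p)).mulShift (c : ZMod p)) := by
    intro c hc
    have hc' : (c : ZMod p) ≠ 0 := by rwa [Ne, ZMod.intCast_zmod_eq_zero_iff_dvd]
    set ψ := (ZMod.stdAddChar (N := p)).mulShift (c : ZMod p) with hψ
    have e1 : GG p c = ∑ x : ZMod p, ψ (x ^ 2) := by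
      unfold GG
      rw [sum_range_zmod p (fun a => EE p (c * (a : ℤ) ^ 2))]
      refine Finset.sum_congr rfl fun x _ => ?_
      have : (c : ZMod p) * x ^ 2 = ((c * (x.val : ℤ) ^ 2 : ℤ) : ZMod p) := by simp
      rw [hψ, AddChar.mulShift_apply, this, ZMod.stdAddChar_coe]
      unfold EE e2
      congr 1
      push_cast
      ring
    have e2' : ∑ t, ψ t = 0 := by
      apply AddChar.sum_eq_zero_of_ne_one
      exact ZMod.isPrimitive_stdAddChar p hc'
    rw [e1, ← Finset.sum_fiberwise (s := Finset.univ) (g := fun x : ZMod p => x ^ 2)]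
    have e3 : ∀ t : ZMod p, ∑ x ∈ Finset.univ with x ^ 2 = t, ψ (x ^ 2) = χ t * ψ t + ψ t := by
      intro t
      have h3 := quadraticChar_card_sqrts (F := ZMod p) (by rwa [ZMod.ringChar_zmod_n]) t
      rw [Finset.sum_congr rfl (g := fun _ => ψ t) (by intro x hx; simp at hx; rw [hx])]
      rw [Finset.sum_const, nsmul_eq_mul]
      have h4 : ((Finset.univ.filter (fun x : ZMod p => x ^ 2 = t)).card : ℂ) = χ t + 1 := by
        have h5 : (({x : ZMod p | x ^ 2 = t}.toFinset.card : ℤ) : ℂ) = χ t + 1 := by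
          rw [h3, hχ]; simp
        rw [← h5]
        simp
      rw [h4]; ring
    rw [Finset.sum_congr rfl (fun t _ => e3 t), Finset.sum_add_distrib, e2', add_zero]
    rfl
  rw [key b hb, key 1 (by
    intro h; have := Int.le_of_dvd one_pos h; have := hp.two_le; omega)]
  have hb' : (b : ZMod p) ≠ 0 := by rwa [Ne, ZMod.intCast_zmod_eq_zero_iff_dvd]
  have h1 := gaussSum_mulShift χ (ZMod.stdAddChar (N := p)) (Units.mk0 _ hb')
  have h2 : χ (b : ZMod p) = (jacobiSym b p : ℂ) := by
    rw [← jacobiSym.legendreSym.to_jacobiSym, hχ]; simp [legendreSym]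
  have h3 : (jacobiSym b p : ℂ) * jacobiSym b p = 1 := by
    rw [← jacobiSym.legendreSym.to_jacobiSym, ← sq]
    exact_mod_cast legendreSym.sq_one p hb'
  rw [Units.val_mk0, h2] at h1
  rw [Int.cast_one, AddChar.mulShift_one, ← h1, ← mul_assoc, h3, one_mul]

lemma GG_pow (p : ℕ) (hp : p.Prime) (hodd : Odd p) (b : ℤ) (hb : ¬ (p : ℤ) ∣ b) (k : ℕ) :
    GG (p ^ k) b = (jacobiSym b (p ^ k) : ℂ) * GG (p ^ k) 1 := by
  have : Fact p.Prime := ⟨hp⟩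
  have hb' : (b : ZMod p) ≠ 0 := by rwa [Ne, ZMod.intCast_zmod_eq_zero_iff_dvd]
  have h3 : jacobiSym b p ^ 2 = 1 := by
    rw [← jacobiSym.legendreSym.to_jacobiSym]
    exact legendreSym.sq_one p hb'
  induction k using Nat.twoStepInduction with
  | zero => simp [GG, EE_zero]
  | one => simpa using GG_prime p hp hodd b hb
  | more k ih _ =>
    rw [GG_rec p hp hodd b hb, GG_rec p hp hodd 1 (by
      intro h; have := Int.le_of_dvd one_pos h; have := hp.two_le; omega), ih]
    rw [jacobiSym.pow_right, jacobiSym.pow_right, pow_add, h3]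
    push_cast
    ring

lemma S_zero (p : ℕ) (hp : p.Prime) (hodd : Odd p) (m u : ℕ) (hu : u < m) (α' β : ℤ)
    (hα : ¬ (p : ℤ) ∣ α') (hβ : (p : ℤ) ^ (u + 1) ∣ β) :
    ∑ a ∈ Finset.range (p ^ m), EE (p ^ m) (2 * a * (p ^ u * α') + a ^ 2 * β) = 0 := by
  have hp0 := hp.pos
  have hN : 0 < p ^ m := by positivity
  have hpZ : Prime (p : ℤ) := Nat.prime_iff_prime_int.1 hp
  have hp2 : ¬ (p : ℤ) ∣ 2 := by
    intro h
    have := Int.le_of_dvd (by norm_num) h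
    have h2 := hp.two_le
    have : p = 2 := by omega
    subst this
    exact absurd hodd (by decide)
  obtain ⟨w, rfl⟩ : ∃ w, m = w + u + 1 := ⟨m - u - 1, by omega⟩
  obtain ⟨γ, rfl⟩ := hβ
  set N := p ^ (w + u + 1) with hNdef
  set f : ℤ → ℂ := fun a => EE N (2 * a * (p ^ u * α') + a ^ 2 * (p ^ (u + 1) * γ)) with hf
  have hper : ∀ a, f (a + N) = f a := by
    intro a
    have := EE_sq_per N hN (p ^ (u + 1) * γ) (2 * (p ^ u * α')) a
    simp only [hf]
    convert this using 2 <;> ring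
  have h1 := sum_shift N hN f hper (p ^ w)
  have h2 : ∀ a : ℤ, f (a + p ^ w) = EE N (2 * p ^ w * (p ^ u * α')) * f a := by
    intro a
    simp only [hf]
    rw [← EE_add]
    apply EE_congr N hN
    apply Int.ModEq.symm
    rw [Int.modEq_iff_dvd]
    exact ⟨γ * (2 * a + p ^ w), by push_cast [hNdef]; ring⟩
  have h3 : EE N (2 * p ^ w * (p ^ u * α')) ≠ 1 := by
    rw [Ne, EE_eq_one_iff N hN]
    intro h
    have h4 : (p : ℤ) ^ (w + u) * p ∣ p ^ (w + u) * (2 * α') := by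
      convert h using 1
      · push_cast [hNdef]; ring
      · ring
    rw [mul_dvd_mul_iff_left (pow_ne_zero _ hpZ.ne_zero)] at h4
    rcases hpZ.dvd_or_dvd h4 with h | h
    · exact hp2 h
    · exact hα h
  simp_rw [h2] at h1
  rw [← Finset.mul_sum] at h1
  have h5 : (EE N (2 * p ^ w * (p ^ u * α')) - 1) * ∑ a ∈ Finset.range N, f a = 0 := by
    rw [sub_mul, h1]; ring
  rcases mul_eq_zero.1 h5 with h | h
  · exact absurd (sub_eq_zero.1 h) h3
  · exact h

lemma val_decomp (p : ℕ) (hp : p.Prime) (α : ℤ) (hα : α ≠ 0) :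
    ∃ α', α = (p : ℤ) ^ (padicValInt p α) * α' ∧ ¬ (p : ℤ) ∣ α' := by
  have : Fact p.Prime := ⟨hp⟩
  obtain ⟨c, hc⟩ := (padicValInt_dvd_iff (p := p) (padicValInt p α) α).2 (Or.inr le_rfl)
  refine ⟨c, hc, ?_⟩
  rintro ⟨d, rfl⟩
  have : (p : ℤ) ^ (padicValInt p α + 1) ∣ α := ⟨d, by rw [pow_succ, mul_assoc]; exact hc⟩
  rw [padicValInt_dvd_iff] at this
  rcases this with h | h
  · exact hα h
  · omega

lemma S_full (p : ℕ) (hp : p.Prime) (m : ℕ) (α β : ℤ)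
    (hα : (p : ℤ) ^ m ∣ α) (hβ : (p : ℤ) ^ m ∣ β) :
    ∑ a ∈ Finset.range (p ^ m), EE (p ^ m) (2 * a * α + a ^ 2 * β) = ((p : ℝ) ^ m : ℝ) := by
  have hp0 := hp.pos
  have : ∀ a ∈ Finset.range (p ^ m), EE (p ^ m) (2 * a * α + a ^ 2 * β) = 1 := by
    intro a _
    rw [EE_eq_one_iff _ (by positivity)]
    push_cast
    exact dvd_add (hα.mul_left _) (hβ.mul_left _)
  rw [Finset.sum_congr rfl this]
  simp

set_option maxHeartbeats 2000000 in
lemma S_main (p : ℕ) (hp : p.Prime) (hodd : Odd p) (m v : ℕ) (hv : v < m) (α' β' c : ℤ)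
    (hβ : ¬ (p : ℤ) ∣ β') (hc : β' * c ≡ α' [ZMOD (p : ℤ) ^ (m - v)]) :
    ∑ a ∈ Finset.range (p ^ m), EE (p ^ m) (2 * a * (p ^ v * α') + a ^ 2 * (p ^ v * β')) =
      (((p : ℝ) ^ (((m : ℝ) + (v : ℝ)) / 2) : ℝ) : ℂ) * eta (p ^ (m - v)) *
        (jacobiSym β' (p ^ (m - v)) : ℂ) * EE (p ^ m) (-(p ^ v * β' * c ^ 2)) := by
  have hp0 := hp.pos
  obtain ⟨k, rfl⟩ : ∃ k, m = k + v := ⟨m - v, by omega⟩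
  rw [Nat.add_sub_cancel] at hc ⊢
  have hP : 0 < p ^ k := by positivity
  have hE : ∀ j : ℤ, EE (p ^ (k + v)) (p ^ v * j) = EE (p ^ k) j := by
    intro j
    have := EE_mul (p ^ k) (p ^ v) (by positivity) j
    rw [← pow_add, Nat.cast_pow] at this
    exact this
  have h1 : ∀ a : ℕ, EE (p ^ (k + v)) (2 * a * (p ^ v * α') + a ^ 2 * (p ^ v * β')) =
      (fun a : ℤ => EE (p ^ k) (β' * a ^ 2 + 2 * α' * a)) a := by
    intro a
    simp only
    rw [← hE]; congr 1; ring
  simp_rw [h1]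
  rw [pow_add p k v, sum_per_mul (p ^ k) (p ^ v) (fun a : ℤ => EE (p ^ k) (β' * a ^ 2 + 2 * α' * a))
    (EE_sq_per _ hP _ _), ← pow_add p k v]
  have h2 : ∀ a : ℕ, EE (p ^ k) (β' * (a : ℤ) ^ 2 + 2 * α' * a) =
      EE (p ^ k) (-(β' * c ^ 2)) * EE (p ^ k) (β' * ((a : ℤ) + c) ^ 2) := by
    intro a
    rw [← EE_add]
    apply EE_congr _ hP
    rw [Int.modEq_iff_dvd]
    obtain ⟨d, hd⟩ := hc.symm.dvd
    refine ⟨2 * a * d, ?_⟩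
    push_cast
    linear_combination (2 * (a : ℤ)) * hd
  simp_rw [h2]
  rw [← Finset.mul_sum, GG_shift _ hP, GG_pow p hp hodd β' hβ, GG_one _ (hodd.pow)]
  rw [show -((p : ℤ) ^ v * β' * c ^ 2) = p ^ v * (-(β' * c ^ 2)) by ring, hE]
  have h3 : ((p : ℝ) ^ ((((k + v : ℕ) : ℝ) + (v : ℝ)) / 2) : ℝ) = (p : ℝ) ^ v * Real.sqrt ((p ^ k : ℕ) : ℝ) := by
    have hpr : (0 : ℝ) < p := by exact_mod_cast hp0
    rw [Real.sqrt_eq_rpow, Nat.cast_pow, ← Real.rpow_natCast, ← Real.rpow_natCast, ← Real.rpow_mul hpr.le,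
      ← Real.rpow_add hpr]
    congr 1
    push_cast
    ring
  rw [h3]
  push_cast
  ring


/-- Evaluation of the quadratic Gauss-type sum
`S = ∑_{a mod p^m} e((2aα + a²β)/p^m)` for an odd prime `p`. -/
theorem quadratic_gauss_sum_eval (p : ℕ) (hp : p.Prime) (hodd : Odd p) (m : ℕ)
    (α β : ℤ) :
    let S : ℂ := ∑ a ∈ Finset.range (p ^ m),
      e2 (((2 * a * α + a ^ 2 * β : ℤ) : ℝ) / (p : ℝ) ^ m)
    ((β = 0 → (p : ℤ) ^ m ∣ α → S = ((p : ℝ) ^ m : ℝ)) ∧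
      (β = 0 → ¬ (p : ℤ) ^ m ∣ α → S = 0) ∧
      (β ≠ 0 → (p : ℤ) ^ m ∣ α → (p : ℤ) ^ m ∣ β → S = ((p : ℝ) ^ m : ℝ)) ∧
      (β ≠ 0 → α ≠ 0 → padicValInt p α < m → padicValInt p α < padicValInt p β →
        S = 0) ∧
      (β ≠ 0 → (p : ℤ) ^ (padicValInt p β) ∣ α → padicValInt p β < m →
        ∀ q : ℤ, (β / (Int.gcd α β : ℤ)) * q ≡ 1 [ZMOD (p : ℤ) ^ (m - padicValInt p β)] →
          S = (((p : ℝ) ^ (((m : ℝ) + (padicValInt p β : ℝ)) / 2) : ℝ) : ℂ) *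
              eta (p ^ (m - padicValInt p β)) *
              ((jacobiSym (β / (p : ℤ) ^ (padicValInt p β)) (p ^ (m - padicValInt p β)) : ℤ) : ℂ) *
              e2 (((-(β * ((α / (Int.gcd α β : ℤ)) * q) ^ 2) : ℤ) : ℝ) / (p : ℝ) ^ m))) := by
  intro S
  have hp0 := hp.pos
  have hpf : Fact p.Prime := ⟨hp⟩
  have hS : S = ∑ a ∈ Finset.range (p ^ m), EE (p ^ m) (2 * a * α + a ^ 2 * β) := by
    refine Finset.sum_congr rfl fun a _ => ?_
    unfold EE
    push_cast
    rfl
  rw [hS]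
  refine ⟨?_, ?_, ?_, ?_, ?_⟩
  · rintro rfl h
    exact S_full p hp m α 0 h (dvd_zero _)
  · rintro rfl h
    have hα : α ≠ 0 := by rintro rfl; exact h (dvd_zero _)
    obtain ⟨α', h1, h2⟩ := val_decomp p hp α hα
    have hlt : padicValInt p α < m := by
      by_contra hc
      exact h ((padicValInt_dvd_iff m α).2 (Or.inr (by omega)))
    generalize padicValInt p α = u at *
    subst h1
    exact S_zero p hp hodd m u hlt α' 0 h2 (dvd_zero _)
  · intro _ h1 h2
    exact S_full p hp m α β h1 h2
  · intro hβ hα hlt hlt2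
    obtain ⟨α', h1, h2⟩ := val_decomp p hp α hα
    have h3 : (p : ℤ) ^ (padicValInt p α + 1) ∣ β := (padicValInt_dvd_iff _ β).2 (Or.inr hlt2)
    generalize padicValInt p α = u at *
    subst h1
    exact S_zero p hp hodd m u hlt α' β h2 h3
  · intro hβ hα hv q hq
    obtain ⟨β', h1, h2⟩ := val_decomp p hp β hβ
    generalize padicValInt p β = v at *
    obtain ⟨α', h3⟩ := hα
    have hpv : ((p : ℤ) ^ v) ≠ 0 := pow_ne_zero _ (by exact_mod_cast hp0.ne')
    have hg0 : (Int.gcd α β : ℤ) ≠ 0 := by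
      have : Int.gcd α β ≠ 0 := by rw [Ne, Int.gcd_eq_zero_iff]; tauto
      exact_mod_cast this
    obtain ⟨δ, hδ⟩ : (p : ℤ) ^ v ∣ (Int.gcd α β : ℤ) :=
      Int.dvd_coe_gcd ⟨_, h3⟩ ⟨_, h1⟩
    obtain ⟨α0, hα0⟩ := Int.gcd_dvd_left α β
    obtain ⟨β0, hβ0⟩ := Int.gcd_dvd_right α β
    have e1 : α / (Int.gcd α β : ℤ) = α0 := Int.ediv_eq_of_eq_mul_right hg0 hα0
    have e2' : β / (Int.gcd α β : ℤ) = β0 := Int.ediv_eq_of_eq_mul_right hg0 hβ0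
    have e3 : β / (p : ℤ) ^ v = β' := Int.ediv_eq_of_eq_mul_right hpv h1
    rw [e2'] at hq
    rw [e1, e3]
    have hA : α' = δ * α0 := by
      apply mul_left_cancel₀ hpv; rw [← h3, ← mul_assoc, ← hδ]; exact hα0
    have hB : β' = δ * β0 := by
      apply mul_left_cancel₀ hpv; rw [← h1, ← mul_assoc, ← hδ]; exact hβ0
    have hc : β' * (α0 * q) ≡ α' [ZMOD (p : ℤ) ^ (m - v)] := by
      have := hq.mul_left (δ * α0)
      rw [hA, hB]
      convert this using 1 <;> ring
    have := S_main p hp hodd m v hv α' β' (α0 * q) h2 hc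
    rw [← h1, ← h3] at this
    rw [this]
    unfold EE
    push_cast
    rfl
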